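/- Let A be a gauge field on T satisfying (τA)(y,x) = 0 for every coarse site y ∈ T' and every x ∈ B(y). Then Σ_p dA(p)² + Σ_{⟨y,y'⟩} ((QA)(y,y'))² ≥ (1/(108L⁴)) Σ_b A(b)², where the first sum runs over all plaquettes of T, the second over all unordered coarse bonds ⟨y,y'⟩ of T', and the third over all unordered bonds b of T. -/

import Mathlib

open Finset

noncomputable section

/-- Points of the discrete torus `(ℤ/Nℤ)³`. -/
abbrev TPt (N : ℕ) : Type := Fin 3 → ZMod N

/-- The standard unit vector `e_μ` in the torus. -/
def unitVec (N : ℕ) (μ : Fin 3) : TPt N := fun i => if i = μ then 1 else 0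

/-- The representative of `a ∈ ℤ/Nℤ` in the symmetric range `{-(N-1)/2, …, (N-1)/2}`
(for odd `N`). -/
def symRep (N : ℕ) (a : ZMod N) : ℤ :=
  if 2 * (a.val : ℤ) + 1 ≤ (N : ℤ) then (a.val : ℤ) else (a.val : ℤ) - (N : ℤ)

/-- Shift a torus point by `k` steps in direction `μ`. -/
def shiftT {N : ℕ} (z : TPt N) (μ : Fin 3) (k : ℤ) : TPt N :=
  fun i => if i = μ then z i + (k : ZMod N) else z i

/-- The sum of the gauge field `A` along the straight lattice path from `z` to `z + t·e_μ`. -/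
def segT {N : ℕ} (A : TPt N → TPt N → ℝ) (z : TPt N) (μ : Fin 3) (t : ℤ) : ℝ :=
  if 0 ≤ t then ∑ j ∈ Finset.range t.toNat, A (shiftT z μ (j : ℤ)) (shiftT z μ ((j : ℤ) + 1))
  else ∑ j ∈ Finset.range (-t).toNat, A (shiftT z μ (-(j : ℤ))) (shiftT z μ (-(j : ℤ) - 1))

/-- The field strength `dA` on the plaquette based at `x` spanned by `e_μ, e_ν`. -/
def plaqT {N : ℕ} (A : TPt N → TPt N → ℝ) (x : TPt N) (μ ν : Fin 3) : ℝ :=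
  A x (x + unitVec N μ) + A (x + unitVec N μ) (x + unitVec N μ + unitVec N ν)
    + A (x + unitVec N μ + unitVec N ν) (x + unitVec N ν) + A (x + unitVec N ν) x

/-- The corner of the rectilinear path `Γ^π_{yx}` reached after the first `m` coordinate
moves. -/
def interPtT {N : ℕ} (y x : TPt N) (π : Equiv.Perm (Fin 3)) (m : ℕ) : TPt N :=
  fun i => if ((π.symm i : Fin 3) : ℕ) < m then x i else y i

/-- `A(Γ^π_{yx})`: the sum of `A` along the rectilinear path (not wrapping around the
torus) from `y` to `x`, moving the coordinates to their final values in the order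
`π 0, π 1, π 2`; the coordinate increments are the symmetric representatives of `x - y`. -/
def gammaSumT {N : ℕ} (A : TPt N → TPt N → ℝ) (π : Equiv.Perm (Fin 3)) (y x : TPt N) : ℝ :=
  ∑ m : Fin 3, segT A (interPtT y x π (m : ℕ)) (π m) (symRep N (x (π m) - y (π m)))

/-- `(τA)(y,x) = (1/6) Σ_π A(Γ^π_{yx})`, averaged over the `3! = 6` permutations. -/
def tauBlk {N : ℕ} (A : TPt N → TPt N → ℝ) (y x : TPt N) : ℝ :=
  (1 / 6) * ∑ π : Equiv.Perm (Fin 3), gammaSumT A π y x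

/-- The block of radius `R` centered at `y`: all `x` whose coordinates relative to `y`
have symmetric representative of absolute value at most `R`. -/
def blockF (N : ℕ) [NeZero N] (R : ℤ) (y : TPt N) : Finset (TPt N) :=
  Finset.univ.filter fun x => ∀ i, |symRep N (x i - y i)| ≤ R

/-- Membership in the coarse lattice `(Lℤ/Nℤ)³ ⊆ (ℤ/Nℤ)³`. -/
def isCoarse (L N : ℕ) (y : TPt N) : Prop :=
  ∀ i, ∃ c : ZMod N, y i = (L : ZMod N) * c

/-- The coarse unit vector `L·e_μ`. -/
def cUnitVec (L N : ℕ) (μ : Fin 3) : TPt N := fun i => if i = μ then (L : ZMod N) else 0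

/-- The block-averaged field on coarse bonds:
`(QA)(y, y+Le_μ) = L⁻⁴ Σ_{x ∈ B(y)} A(Γ_{x,x+Le_μ})`. -/
def Qc (L : ℕ) {N : ℕ} [NeZero N] (A : TPt N → TPt N → ℝ) (y : TPt N) (μ : Fin 3) : ℝ :=
  ((L : ℝ) ^ 4)⁻¹ * ∑ x ∈ blockF N (((L : ℤ) - 1) / 2) y, segT A x μ (L : ℤ)


/-- The torus vector with entry `k` in direction `μ`. -/
def shv (N : ℕ) (μ : Fin 3) (k : ℤ) : TPt N := fun i => if i = μ then (k : ZMod N) else 0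

/-- Reduction of an integer vector to the torus. -/
def cvec (N : ℕ) (o : Fin 3 → ℤ) : TPt N := fun i => (o i : ZMod N)

lemma shiftT_eq {N : ℕ} (z : TPt N) (μ : Fin 3) (k : ℤ) : shiftT z μ k = z + shv N μ k := by
  funext i; simp only [shiftT, shv, Pi.add_apply]; split_ifs <;> simp

lemma unitVec_eq (N : ℕ) (μ : Fin 3) : unitVec N μ = shv N μ 1 := by
  funext i; simp [unitVec, shv]

lemma shv_add (N : ℕ) (μ : Fin 3) (a b : ℤ) : shv N μ (a + b) = shv N μ a + shv N μ b := by
  funext i; simp only [shv, Pi.add_apply]; split_ifs <;> simp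

lemma shv_zero (N : ℕ) (μ : Fin 3) : shv N μ 0 = 0 := by
  funext i; simp [shv]

lemma shv_neg (N : ℕ) (μ : Fin 3) (a : ℤ) : shv N μ (-a) = - shv N μ a := by
  funext i; simp only [shv, Pi.neg_apply]; split_ifs <;> simp

lemma seg_zero {N : ℕ} (A : TPt N → TPt N → ℝ) (z : TPt N) (μ : Fin 3) : segT A z μ 0 = 0 := by
  simp [segT]

lemma seg_succ {N : ℕ} (A : TPt N → TPt N → ℝ) (hA : ∀ x x', A x x' = - A x' x)
    (z : TPt N) (μ : Fin 3) (t : ℤ) :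
    segT A z μ (t + 1) = segT A z μ t + A (z + shv N μ t) (z + shv N μ t + shv N μ 1) := by
  rcases le_or_gt 0 t with h | h
  · lift t to ℕ using h
    have h1 : (0 : ℤ) ≤ (t : ℤ) + 1 := by omega
    have h2 : ((t : ℤ) + 1).toNat = t + 1 := by omega
    simp only [segT, h1, if_true, h2, Finset.sum_range_succ, Int.toNat_natCast, Nat.cast_nonneg,
      shiftT_eq, shv_add, add_assoc]
  · obtain ⟨n, rfl⟩ : ∃ n : ℕ, t = -((n : ℤ) + 1) := ⟨(-t - 1).toNat, by omega⟩
    have h3 : ¬ (0 : ℤ) ≤ -((n : ℤ) + 1) := by omega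
    have h4 : (- -((n : ℤ) + 1)).toNat = n + 1 := by omega
    have h5 : segT A z μ (-((n : ℤ) + 1) + 1)
        = ∑ j ∈ Finset.range n, A (shiftT z μ (-(j : ℤ))) (shiftT z μ (-(j : ℤ) - 1)) := by
      rcases Nat.eq_zero_or_pos n with rfl | hn
      · simp [segT]
      · have h6 : ¬ (0 : ℤ) ≤ -((n : ℤ) + 1) + 1 := by omega
        have h7 : (-(-((n : ℤ) + 1) + 1)).toNat = n := by omega
        simp only [segT, h6, if_false, h7]
    rw [h5]
    simp only [segT, h3, if_false, h4, Finset.sum_range_succ, shiftT_eq]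
    rw [hA (z + shv N μ (-((n : ℤ) + 1)))]
    have h8 : z + shv N μ (-((n : ℤ) + 1)) + shv N μ 1 = z + shv N μ (-(n : ℤ)) := by
      rw [add_assoc, ← shv_add]; congr 2; ring
    have h9 : -((n : ℤ) + 1) = -(n : ℤ) - 1 := by ring
    rw [h8, h9]; ring

lemma seg_add {N : ℕ} (A : TPt N → TPt N → ℝ) (hA : ∀ x x', A x x' = - A x' x)
    (z : TPt N) (μ : Fin 3) (s t : ℤ) :
    segT A z μ (s + t) = segT A z μ s + segT A (z + shv N μ s) μ t := by
  induction t using Int.induction_on with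
  | zero => simp [seg_zero]
  | succ n ih =>
    rw [← add_assoc, seg_succ A hA, ih, seg_succ A hA, shv_add]
    simp only [add_assoc]
  | pred n ih =>
    have h1 := seg_succ A hA z μ (s + (-(n : ℤ) - 1))
    have h2 := seg_succ A hA (z + shv N μ s) μ (-(n : ℤ) - 1)
    rw [show s + (-(n : ℤ) - 1) + 1 = s + -(n : ℤ) by ring, shv_add] at h1
    rw [show -(n : ℤ) - 1 + 1 = -(n : ℤ) by ring] at h2
    simp only [add_assoc] at h1 h2 ih ⊢
    linarith

lemma seg_one {N : ℕ} (A : TPt N → TPt N → ℝ) (z : TPt N) (μ : Fin 3) :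
    segT A z μ 1 = A z (z + unitVec N μ) := by
  simp [segT, shiftT_eq, shv_zero, unitVec_eq]

lemma seg_neg {N : ℕ} (A : TPt N → TPt N → ℝ) (hA : ∀ x x', A x x' = - A x' x)
    (z : TPt N) (μ : Fin 3) (t : ℤ) :
    segT A z μ (-t) = - segT A (z + shv N μ (-t)) μ t := by
  have := seg_add A hA z μ (-t) t
  rw [neg_add_cancel, seg_zero] at this
  linarith

/-- Circulation of `A` around a rectangle. -/
def rectT {N : ℕ} (A : TPt N → TPt N → ℝ) (z : TPt N) (μ ν : Fin 3) (s t : ℤ) : ℝ :=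
  segT A z ν t + segT A (z + shv N ν t) μ s - segT A (z + shv N μ s) ν t - segT A z μ s

lemma rect_one_one {N : ℕ} (A : TPt N → TPt N → ℝ) (hA : ∀ x x', A x x' = - A x' x)
    (z : TPt N) (μ ν : Fin 3) : rectT A z μ ν 1 1 = - plaqT A z μ ν := by
  simp only [rectT, seg_one, plaqT, ← unitVec_eq]
  rw [hA (z + unitVec N μ + unitVec N ν), hA (z + unitVec N ν) z,
    add_right_comm z (unitVec N μ) (unitVec N ν)]
  ring

lemma rect_succ_left {N : ℕ} (A : TPt N → TPt N → ℝ) (hA : ∀ x x', A x x' = - A x' x)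
    (z : TPt N) (μ ν : Fin 3) (s s' t : ℤ) :
    rectT A z μ ν (s + s') t = rectT A z μ ν s t + rectT A (z + shv N μ s) μ ν s' t := by
  simp only [rectT, seg_add A hA, shv_add]
  rw [add_right_comm z (shv N ν t) (shv N μ s), ← add_assoc z (shv N μ s)]
  ring

lemma rect_succ_right {N : ℕ} (A : TPt N → TPt N → ℝ) (hA : ∀ x x', A x x' = - A x' x)
    (z : TPt N) (μ ν : Fin 3) (s t t' : ℤ) :
    rectT A z μ ν s (t + t') = rectT A z μ ν s t + rectT A (z + shv N ν t) μ ν s t' := by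
  simp only [rectT, seg_add A hA, shv_add]
  rw [add_right_comm z (shv N μ s) (shv N ν t), ← add_assoc z (shv N ν t)]
  ring

lemma rect_one_nat {N : ℕ} (A : TPt N → TPt N → ℝ) (hA : ∀ x x', A x x' = - A x' x)
    (z : TPt N) (μ ν : Fin 3) (t : ℕ) :
    rectT A z μ ν 1 t = ∑ j ∈ Finset.range t, - plaqT A (z + shv N ν j) μ ν := by
  induction t with
  | zero => simp [rectT, seg_zero, shv_zero]
  | succ n ih =>
    rw [Finset.sum_range_succ, ← ih, Nat.cast_succ, rect_succ_right A hA, rect_one_one A hA]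

lemma rect_nat_nat {N : ℕ} (A : TPt N → TPt N → ℝ) (hA : ∀ x x', A x x' = - A x' x)
    (z : TPt N) (μ ν : Fin 3) (s t : ℕ) :
    rectT A z μ ν s t = ∑ i ∈ Finset.range s, ∑ j ∈ Finset.range t,
      - plaqT A (z + shv N μ i + shv N ν j) μ ν := by
  induction s with
  | zero => simp [rectT, seg_zero, shv_zero]
  | succ n ih =>
    rw [Finset.sum_range_succ, ← ih, Nat.cast_succ, rect_succ_left A hA, rect_one_nat A hA]

lemma rect_neg {N : ℕ} (A : TPt N → TPt N → ℝ) (hA : ∀ x x', A x x' = - A x' x)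
    (z : TPt N) (μ ν : Fin 3) (s t : ℤ) :
    rectT A z μ ν s (-t) = - rectT A (z + shv N ν (-t)) μ ν s t := by
  have := rect_succ_right A hA z μ ν s (-t) t
  rw [neg_add_cancel] at this
  have h0 : rectT A z μ ν s 0 = 0 := by simp [rectT, seg_zero, shv_zero]
  linarith

/-- Energy density at a point. -/
def eden {N : ℕ} (A : TPt N → TPt N → ℝ) (z : TPt N) : ℝ :=
  ∑ α : Fin 3, ∑ β : Fin 3, if α < β then (plaqT A z α β) ^ 2 else 0

lemma eden_nonneg {N : ℕ} (A : TPt N → TPt N → ℝ) (z : TPt N) : 0 ≤ eden A z := by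
  unfold eden
  refine Finset.sum_nonneg fun α _ => Finset.sum_nonneg fun β _ => ?_
  split_ifs <;> positivity

lemma plaq_swap {N : ℕ} (A : TPt N → TPt N → ℝ) (hA : ∀ x x', A x x' = - A x' x)
    (z : TPt N) (μ ν : Fin 3) : plaqT A z μ ν = - plaqT A z ν μ := by
  simp only [plaqT]
  rw [hA (z + unitVec N μ + unitVec N ν), hA (z + unitVec N ν) z,
    hA (z + unitVec N ν + unitVec N μ), hA (z + unitVec N μ) z,
    add_right_comm z (unitVec N μ) (unitVec N ν)]
  ring

lemma plaq_le_eden {N : ℕ} (A : TPt N → TPt N → ℝ) (hA : ∀ x x', A x x' = - A x' x)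
    (z : TPt N) (μ ν : Fin 3) (h : μ ≠ ν) : (plaqT A z μ ν) ^ 2 ≤ eden A z := by
  have key : ∀ μ ν : Fin 3, μ < ν → (plaqT A z μ ν) ^ 2 ≤ eden A z := by
    intro μ ν h
    have hnn : ∀ α β : Fin 3, 0 ≤ (if α < β then (plaqT A z α β) ^ 2 else 0) := by
      intro α β; split_ifs <;> positivity
    calc (plaqT A z μ ν) ^ 2 = (if μ < ν then (plaqT A z μ ν) ^ 2 else 0) := by rw [if_pos h]
      _ ≤ ∑ β : Fin 3, (if μ < β then (plaqT A z μ β) ^ 2 else 0) :=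
        Finset.single_le_sum (f := fun β => if μ < β then (plaqT A z μ β) ^ 2 else 0)
          (fun β _ => hnn μ β) (Finset.mem_univ ν)
      _ ≤ eden A z :=
        Finset.single_le_sum
          (f := fun α => ∑ β : Fin 3, if α < β then (plaqT A z α β) ^ 2 else 0)
          (fun α _ => Finset.sum_nonneg fun β _ => hnn α β) (Finset.mem_univ μ)
  rcases lt_or_gt_of_ne h with h | h
  · exact key _ _ h
  · rw [plaq_swap A hA, neg_sq]; exact key _ _ h

/-- Rectangle bound, given a finset that contains the base points. -/
lemma rect_bound_nat {N : ℕ} (A : TPt N → TPt N → ℝ) (hA : ∀ x x', A x x' = - A x' x)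
    (z : TPt N) (μ ν : Fin 3) (h : μ ≠ ν) (s t : ℕ) (hs : s ≤ N) (ht : t ≤ N)
    (S : Finset (TPt N))
    (hS : ∀ i : ℕ, i < s → ∀ j : ℕ, j < t → z + shv N μ i + shv N ν j ∈ S) :
    (rectT A z μ ν s t) ^ 2 ≤ (s * t : ℝ) * ∑ w ∈ S, eden A w := by
  classical
  rw [rect_nat_nat A hA, ← Finset.sum_product']
  refine (sq_sum_le_card_mul_sum_sq).trans ?_
  rw [Finset.card_product, Finset.card_range, Finset.card_range, Nat.cast_mul]
  refine mul_le_mul_of_nonneg_left ?_ (by positivity)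
  calc ∑ p ∈ Finset.range s ×ˢ Finset.range t, (- plaqT A (z + shv N μ p.1 + shv N ν p.2) μ ν) ^ 2
      ≤ ∑ p ∈ Finset.range s ×ˢ Finset.range t, eden A (z + shv N μ p.1 + shv N ν p.2) := by
        refine Finset.sum_le_sum fun p _ => ?_
        rw [neg_sq]; exact plaq_le_eden A hA _ _ _ h
    _ = ∑ w ∈ (Finset.range s ×ˢ Finset.range t).image
          (fun p : ℕ × ℕ => z + shv N μ p.1 + shv N ν p.2), eden A w := by
        rw [Finset.sum_image]
        rintro ⟨i, j⟩ hp ⟨i', j'⟩ hp' he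
        simp only [Finset.coe_product, Finset.coe_range, Set.mem_prod, Set.mem_Iio] at hp hp'
        have e1 := congrFun he μ
        have e2 := congrFun he ν
        simp only [Pi.add_apply, shv, if_true, h, h.symm, if_false, add_zero, add_right_inj,
          Int.cast_natCast] at e1 e2
        have e1 := (ZMod.natCast_eq_natCast_iff' _ _ _).1 e1
        have e2 := (ZMod.natCast_eq_natCast_iff' _ _ _).1 e2
        rw [Nat.mod_eq_of_lt (by omega), Nat.mod_eq_of_lt (by omega)] at e1 e2
        simp [e1, e2]
    _ ≤ ∑ w ∈ S, eden A w := by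
        refine Finset.sum_le_sum_of_subset_of_nonneg ?_ fun w _ _ => eden_nonneg A w
        intro w hw
        obtain ⟨p, hp, rfl⟩ := Finset.mem_image.1 hw
        rw [Finset.mem_product, Finset.mem_range, Finset.mem_range] at hp
        exact hS _ hp.1 _ hp.2

lemma rect_bound {N : ℕ} (A : TPt N → TPt N → ℝ) (hA : ∀ x x', A x x' = - A x' x)
    (z : TPt N) (μ ν : Fin 3) (h : μ ≠ ν) (s : ℕ) (t : ℤ) (hs : s ≤ N) (ht : |t| ≤ N)
    (S : Finset (TPt N))
    (hS : ∀ i : ℤ, 0 ≤ i → i < s → ∀ j : ℤ, |j| ≤ |t| → 0 ≤ j * t →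
      z + shv N μ i + shv N ν j ∈ S) :
    (rectT A z μ ν s t) ^ 2 ≤ (s * |t| : ℝ) * ∑ w ∈ S, eden A w := by
  rcases le_total 0 t with h0 | h0
  · lift t to ℕ using h0
    have := rect_bound_nat A hA z μ ν h s t hs (by simpa using ht) S (fun i hi j hj => by
      refine hS i (by positivity) (by exact_mod_cast hi) j ?_ (by positivity)
      rw [Nat.abs_cast, Nat.abs_cast]; exact_mod_cast hj.le)
    simpa using this
  · obtain ⟨n, rfl⟩ : ∃ n : ℕ, t = -(n : ℤ) := ⟨(-t).toNat, by omega⟩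
    rw [rect_neg A hA, neg_sq]
    have := rect_bound_nat A hA (z + shv N ν (-(n : ℤ))) μ ν h s n hs (by simpa using ht) S
      (fun i hi j hj => by
      have := hS i (by positivity) (by exact_mod_cast hi) (-(n : ℤ) + j) (by
        rw [abs_neg, Nat.abs_cast, abs_le]; omega) (by
          have : (j : ℤ) ≤ n := by exact_mod_cast hj.le
          nlinarith)
      rw [shv_add] at this
      convert this using 1
      abel)
    simpa using this

lemma symRep_cast (N : ℕ) [NeZero N] (k : ℤ) (hk : 2 * |k| < N) : symRep N (k : ZMod N) = k := by
  have hv : (((k : ZMod N)).val : ℤ) = k % N := ZMod.val_intCast k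
  unfold symRep
  rw [hv]
  rcases le_or_gt 0 k with h | h
  · rw [abs_of_nonneg h] at hk
    rw [Int.emod_eq_of_lt h (by omega), if_pos (by omega)]
  · rw [abs_of_neg h] at hk
    have : k % N = k + N := by
      rw [← Int.add_emod_right, Int.emod_eq_of_lt (by omega) (by omega)]
    rw [this, if_neg (by omega)]; ring

lemma cast_symRep (N : ℕ) [NeZero N] (a : ZMod N) : ((symRep N a : ℤ) : ZMod N) = a := by
  unfold symRep
  split_ifs <;> simp

/-- Integer offsets of a block. -/
def obox (R : ℤ) : Finset (Fin 3 → ℤ) := Fintype.piFinset fun _ => Finset.Icc (-R) R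

lemma mem_box {R : ℤ} {o : Fin 3 → ℤ} : o ∈ obox R ↔ ∀ i, |o i| ≤ R := by
  simp [obox, Fintype.mem_piFinset, abs_le]

lemma block_eq (N : ℕ) [NeZero N] (R : ℤ) (hR : 2 * R < N) (y : TPt N) :
    blockF N R y = (obox R).image (fun o => y + cvec N o) := by
  ext x
  simp only [blockF, Finset.mem_filter, Finset.mem_univ, true_and, Finset.mem_image, mem_box]
  constructor
  · intro h
    refine ⟨fun i => symRep N (x i - y i), h, ?_⟩
    funext i
    simp [cvec, cast_symRep]
  · rintro ⟨o, ho, rfl⟩ i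
    have := ho i
    simp only [cvec, Pi.add_apply, add_sub_cancel_left]
    rw [symRep_cast _ _ (by omega)]
    exact this

lemma block_inj (N : ℕ) [NeZero N] (R : ℤ) (hR : 2 * R < N) (y : TPt N) :
    Set.InjOn (fun o => y + cvec N o) (obox R : Set (Fin 3 → ℤ)) := by
  intro o ho o' ho' h
  rw [Finset.mem_coe, mem_box] at ho ho'
  funext i
  have h1 := congrFun h i
  simp only [cvec, Pi.add_apply, add_right_inj] at h1
  have a := ho i
  have b := ho' i
  rw [← symRep_cast N (o i) (by omega), ← symRep_cast N (o' i) (by omega), h1]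

lemma mem_block (N : ℕ) [NeZero N] (R : ℤ) (hR : 2 * R < N) (y : TPt N) (o : Fin 3 → ℤ)
    (ho : ∀ i, |o i| ≤ R) : y + cvec N o ∈ blockF N R y := by
  rw [block_eq N R hR]
  exact Finset.mem_image.2 ⟨o, mem_box.2 ho, rfl⟩

/-- Offset of the `m`-th corner of the path. -/
def opart (π : Equiv.Perm (Fin 3)) (o : Fin 3 → ℤ) (m : ℕ) : Fin 3 → ℤ :=
  fun i => if ((π.symm i : Fin 3) : ℕ) < m then o i else 0

lemma gamma_eq {N : ℕ} [NeZero N] (A : TPt N → TPt N → ℝ) (π : Equiv.Perm (Fin 3)) (y : TPt N)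
    (o : Fin 3 → ℤ) (ho : ∀ i, 2 * |o i| < N) :
    gammaSumT A π y (y + cvec N o)
      = ∑ m : Fin 3, segT A (y + cvec N (opart π o m)) (π m) (o (π m)) := by
  unfold gammaSumT
  refine Finset.sum_congr rfl fun m _ => ?_
  congr 1
  · funext i
    simp only [interPtT, opart, cvec, Pi.add_apply]
    split_ifs <;> simp
  · simp only [cvec, Pi.add_apply, add_sub_cancel_left]
    exact symRep_cast _ _ (ho _)

/-- Shift of the `m`-th corner. -/
def sig (π : Equiv.Perm (Fin 3)) (μ : Fin 3) (D s : ℕ) (m : ℕ) : ℕ :=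
  if ((π.symm μ : Fin 3) : ℕ) < m then s else D

/-- Surface term. -/
def rterm {N : ℕ} (A : TPt N → TPt N → ℝ) (π : Equiv.Perm (Fin 3)) (y : TPt N)
    (o : Fin 3 → ℤ) (μ : Fin 3) (D s : ℕ) (m : Fin 3) : ℝ :=
  if π m = μ then 0
  else rectT A (y + cvec N (opart π o m)) μ (π m) (sig π μ D s m) (o (π m))

lemma corner_succ (N : ℕ) (π : Equiv.Perm (Fin 3)) (y : TPt N) (o : Fin 3 → ℤ) (m : Fin 3) :
    y + cvec N (opart π o ((m : ℕ) + 1))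
      = y + cvec N (opart π o m) + shv N (π m) (o (π m)) := by
  funext i
  simp only [cvec, opart, shv, Pi.add_apply]
  by_cases h : i = π m
  · subst h; simp
  · have h' : ((π.symm i : Fin 3) : ℕ) ≠ m := fun hh => h (by
      have := Fin.ext hh; rw [← this]; simp)
    have e : ((π.symm i : Fin 3) : ℕ) < (m : ℕ) + 1 ↔ ((π.symm i : Fin 3) : ℕ) < m := by omega
    simp [h, e]

lemma corner_shift (N : ℕ) (π : Equiv.Perm (Fin 3)) (y : TPt N) (o : Fin 3 → ℤ) (μ : Fin 3)
    (D s : ℕ) (m : ℕ) :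
    y + shv N μ D + cvec N (opart π (Function.update o μ (o μ + s - D)) m)
      = y + cvec N (opart π o m) + shv N μ (sig π μ D s m) := by
  funext i
  simp only [cvec, opart, shv, Pi.add_apply, sig]
  by_cases h : i = μ
  · subst h
    by_cases h2 : ((π.symm i : Fin 3) : ℕ) < m
    · simp [h2]; ring
    · simp [h2]
  · simp [h]

lemma step_eq {N : ℕ} (A : TPt N → TPt N → ℝ) (hA : ∀ x x', A x x' = - A x' x)
    (π : Equiv.Perm (Fin 3)) (y : TPt N) (o : Fin 3 → ℤ) (μ : Fin 3) (D s : ℕ) (m : Fin 3) :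
    segT A (y + cvec N (opart π o m)) (π m) (o (π m))
      + segT A (y + cvec N (opart π o ((m : ℕ) + 1))) μ (sig π μ D s ((m : ℕ) + 1))
      - segT A (y + shv N μ D + cvec N (opart π (Function.update o μ (o μ + s - D)) m)) (π m)
          (Function.update o μ (o μ + s - D) (π m))
      - segT A (y + cvec N (opart π o m)) μ (sig π μ D s m) = rterm A π y o μ D s m := by
  rw [corner_succ, corner_shift]
  unfold rterm
  by_cases h : π m = μ
  · subst h
    have h1 : sig π (π m) D s m = D := by simp [sig]
    have h2 : sig π (π m) D s ((m : ℕ) + 1) = s := by simp [sig]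
    rw [h1, h2, if_pos rfl, Function.update_self]
    have e1 := seg_add A hA (y + cvec N (opart π o m)) (π m) (o (π m)) s
    have e2 := seg_add A hA (y + cvec N (opart π o m)) (π m) D (o (π m) + s - D)
    rw [show (D : ℤ) + (o (π m) + s - D) = o (π m) + s by ring] at e2
    linarith
  · have h' : ((π.symm μ : Fin 3) : ℕ) ≠ m := fun hh => h (by
      have := Fin.ext hh; rw [← this]; simp)
    have e : ((π.symm μ : Fin 3) : ℕ) < (m : ℕ) + 1 ↔ ((π.symm μ : Fin 3) : ℕ) < m := by omega
    have h1 : sig π μ D s ((m : ℕ) + 1) = sig π μ D s m := by simp [sig, e]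
    rw [h1, if_neg h, Function.update_of_ne h, rectT]

lemma loop_eq {N : ℕ} [NeZero N] (A : TPt N → TPt N → ℝ) (hA : ∀ x x', A x x' = - A x' x)
    (π : Equiv.Perm (Fin 3)) (y : TPt N) (o : Fin 3 → ℤ) (μ : Fin 3) (D s : ℕ)
    (ho : ∀ i, 2 * |o i| < N) (ho' : 2 * |o μ + s - D| < N) :
    gammaSumT A π y (y + cvec N o) + segT A (y + cvec N o) μ s
      - gammaSumT A π (y + shv N μ D)
          (y + shv N μ D + cvec N (Function.update o μ (o μ + s - D)))
      - segT A y μ D = ∑ m : Fin 3, rterm A π y o μ D s m := by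
  rw [gamma_eq A π y o ho, gamma_eq A π _ _ (by
    intro i
    by_cases h : i = μ
    · subst h; simpa using ho'
    · simpa [h] using ho i)]
  have h := fun m => step_eq A hA π y o μ D s m
  simp only [← h, Fin.sum_univ_three]
  have e3 : y + cvec N (opart π o 3) = y + cvec N o := by
    congr 2; funext i
    have : ((π.symm i : Fin 3) : ℕ) < 3 := (π.symm i).2
    simp [opart]
  have e0 : y + cvec N (opart π o 0) = y := by
    funext i; simp [opart, cvec]
  have s3 : sig π μ D s 3 = s := by
    have : ((π.symm μ : Fin 3) : ℕ) < 3 := (π.symm μ).2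
    simp [sig]
  have s0 : sig π μ D s 0 = D := by simp [sig]
  simp only [Fin.val_zero, Fin.val_one, Fin.val_two, zero_add, Nat.reduceAdd, e3, e0, s3, s0]
  ring

/-- Block energy. -/
def blkE {N : ℕ} [NeZero N] (A : TPt N → TPt N → ℝ) (R : ℤ) (y : TPt N) : ℝ :=
  ∑ w ∈ blockF N R y, eden A w

lemma blkE_nonneg {N : ℕ} [NeZero N] (A : TPt N → TPt N → ℝ) (R : ℤ) (y : TPt N) :
    0 ≤ blkE A R y := Finset.sum_nonneg fun w _ => eden_nonneg A w

lemma mem_two_blocks (N : ℕ) [NeZero N] (L : ℕ) (R : ℤ) (hL : (L : ℤ) = 2 * R + 1)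
    (hR : 2 * R < N) (y : TPt N) (μ : Fin 3) (D : ℕ) (hD : D = 0 ∨ D = L) (w : Fin 3 → ℤ)
    (hw : ∀ i, i ≠ μ → |w i| ≤ R) (h1 : -R ≤ w μ) (h2 : w μ ≤ R + D) :
    y + cvec N w ∈ blockF N R y ∪ blockF N R (y + shv N μ D) := by
  rw [Finset.mem_union]
  by_cases h : w μ ≤ R
  · left
    refine mem_block N R hR y w fun i => ?_
    by_cases hi : i = μ
    · subst hi; exact abs_le.2 ⟨h1, h⟩
    · exact hw i hi
  · right
    have e : y + cvec N w = y + shv N μ D + cvec N (Function.update w μ (w μ - D)) := by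
      funext i
      by_cases hi : i = μ
      · subst hi; simp [cvec, shv]
      · simp [cvec, shv, hi]
    rw [e]
    refine mem_block N R hR _ _ fun i => ?_
    by_cases hi : i = μ
    · subst hi
      rw [Function.update_self, abs_le]
      rcases hD with rfl | rfl <;> constructor <;> push_cast at * <;> omega
    · rw [Function.update_of_ne hi]; exact hw i hi

lemma rterm_bound {N : ℕ} [NeZero N] (A : TPt N → TPt N → ℝ) (hA : ∀ x x', A x x' = - A x' x)
    (L : ℕ) (R : ℤ) (hL : (L : ℤ) = 2 * R + 1) (hR0 : 0 ≤ R)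
    (hR : 2 * R < N) (π : Equiv.Perm (Fin 3)) (y : TPt N) (o : Fin 3 → ℤ) (μ : Fin 3) (D s S : ℕ)
    (hD : D = 0 ∨ D = L) (hDS : D ≤ S) (hsS : s ≤ S) (hSN : S ≤ N)
    (ho : ∀ i, |o i| ≤ R) (ho' : |o μ + s - D| ≤ R) (m : Fin 3) :
    (rterm A π y o μ D s m) ^ 2 ≤ (R * S : ℝ) * (blkE A R y + blkE A R (y + shv N μ D)) := by
  have hE := blkE_nonneg A R y
  have hE' := blkE_nonneg A R (y + shv N μ D)
  have hRr : (0 : ℝ) ≤ R := by exact_mod_cast hR0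
  unfold rterm
  split_ifs with h
  · rw [zero_pow two_ne_zero]; positivity
  · have hsig : sig π μ D s m ≤ S := by unfold sig; split_ifs <;> assumption
    refine (rect_bound A hA (y + cvec N (opart π o m)) μ (π m) (Ne.symm h) (sig π μ D s m)
      (o (π m)) (hsig.trans hSN) (by have := ho (π m); omega)
      (blockF N R y ∪ blockF N R (y + shv N μ D)) ?_).trans ?_
    · intro i hi0 hi j hj _
      have e : y + cvec N (opart π o m) + shv N μ i + shv N (π m) j
          = y + cvec N (fun k => opart π o m k + (if k = μ then i else 0)
              + (if k = π m then j else 0)) := by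
        funext k
        simp only [cvec, shv, Pi.add_apply]
        push_cast
        split_ifs <;> push_cast <;> ring
      rw [e]
      have hμ : μ ≠ π m := Ne.symm h
      have b1 := abs_le.1 (ho μ)
      have b2 := abs_le.1 ho'
      refine mem_two_blocks N L R hL hR y μ D hD _ ?_ ?_ ?_
      · intro k hk
        by_cases hkm : k = π m
        · subst hkm
          simp only [opart, Equiv.symm_apply_apply, lt_irrefl, if_false, hk, if_true, zero_add]
          exact hj.trans (ho _)
        · simp only [opart, hk, hkm, if_false, add_zero]
          split_ifs
          · exact ho k
          · simpa using hR0
      · simp only [opart, hμ, if_true, if_false, add_zero]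
        split_ifs <;> omega
      · simp only [opart, hμ, if_true, if_false, add_zero]
        unfold sig at hi
        split_ifs at hi ⊢ <;> omega
    · have u : ∑ w ∈ blockF N R y ∪ blockF N R (y + shv N μ D), eden A w
          ≤ blkE A R y + blkE A R (y + shv N μ D) := by
        unfold blkE
        rw [← Finset.sum_union_inter]
        have := Finset.sum_nonneg (s := blockF N R y ∩ blockF N R (y + shv N μ D))
          (fun w _ => eden_nonneg A w)
        linarith
      have v : (|(o (π m) : ℝ)|) ≤ R := by exact_mod_cast ho (π m)
      have v2 : ((sig π μ D s m : ℕ) : ℝ) ≤ S := by exact_mod_cast hsig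
      have u0 := Finset.sum_nonneg (s := blockF N R y ∪ blockF N R (y + shv N μ D))
          (fun w _ => eden_nonneg A w)
      rw [mul_comm (R : ℝ)]
      push_cast
      gcongr

lemma rsum_bound {N : ℕ} [NeZero N] (A : TPt N → TPt N → ℝ) (hA : ∀ x x', A x x' = - A x' x)
    (L : ℕ) (R : ℤ) (hL : (L : ℤ) = 2 * R + 1) (hR0 : 0 ≤ R)
    (hR : 2 * R < N) (π : Equiv.Perm (Fin 3)) (y : TPt N) (o : Fin 3 → ℤ) (μ : Fin 3) (D s S : ℕ)
    (hD : D = 0 ∨ D = L) (hDS : D ≤ S) (hsS : s ≤ S) (hSN : S ≤ N)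
    (ho : ∀ i, |o i| ≤ R) (ho' : |o μ + s - D| ≤ R) :
    (∑ m : Fin 3, rterm A π y o μ D s m) ^ 2
      ≤ 4 * ((R * S : ℝ) * (blkE A R y + blkE A R (y + shv N μ D))) := by
  have hz : rterm A π y o μ D s (π.symm μ) = 0 := by simp [rterm]
  rw [← Finset.add_sum_erase _ _ (Finset.mem_univ (π.symm μ)), hz, zero_add]
  have hc : (Finset.univ.erase (π.symm μ)).card = 2 := by
    rw [Finset.card_erase_of_mem (Finset.mem_univ _)]; simp
  refine (sq_sum_le_card_mul_sum_sq).trans ?_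
  have := Finset.sum_le_card_nsmul (Finset.univ.erase (π.symm μ))
    (fun m => (rterm A π y o μ D s m) ^ 2) _
    (fun m _ => rterm_bound A hA L R hL hR0 hR π y o μ D s S hD hDS hsS hSN ho ho' m)
  rw [hc, nsmul_eq_mul] at this
  rw [hc]
  push_cast at *
  linarith

lemma loop_bound {N : ℕ} [NeZero N] (A : TPt N → TPt N → ℝ) (hA : ∀ x x', A x x' = - A x' x)
    (L : ℕ) (R : ℤ) (hL : (L : ℤ) = 2 * R + 1) (hR0 : 0 ≤ R)
    (hR : 2 * R < N) (y : TPt N) (o : Fin 3 → ℤ) (μ : Fin 3) (D s S : ℕ)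
    (hD : D = 0 ∨ D = L) (hDS : D ≤ S) (hsS : s ≤ S) (hSN : S ≤ N)
    (ho : ∀ i, |o i| ≤ R) (ho' : |o μ + s - D| ≤ R)
    (ht : ∀ x ∈ blockF N R y, tauBlk A y x = 0)
    (ht' : ∀ x ∈ blockF N R (y + shv N μ D), tauBlk A (y + shv N μ D) x = 0) :
    (segT A (y + cvec N o) μ s - segT A y μ D) ^ 2
      ≤ 2 * (L * S : ℝ) * (blkE A R y + blkE A R (y + shv N μ D)) := by
  set x' := y + shv N μ D + cvec N (Function.update o μ (o μ + s - D)) with hx'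
  have t1 := ht _ (mem_block N R hR y o ho)
  have t2 := ht' x' (mem_block N R hR _ _ (by
    intro i
    by_cases h : i = μ
    · subst h; simpa using ho'
    · simpa [h] using ho i))
  have hcard : (Finset.univ : Finset (Equiv.Perm (Fin 3))).card = 6 := by
    rw [Finset.card_univ, Fintype.card_perm]; rfl
  have hl := fun π => loop_eq A hA π y o μ D s (fun i => by have := ho i; omega) (by omega)
  have hsum := Finset.sum_congr (rfl : (Finset.univ : Finset (Equiv.Perm (Fin 3))) = _)
    (fun π _ => hl π)
  simp only [Finset.sum_sub_distrib, Finset.sum_add_distrib, Finset.sum_const, hcard,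
    nsmul_eq_mul] at hsum
  rw [← hx'] at hsum
  unfold tauBlk at t1 t2
  have hX : 6 * (segT A (y + cvec N o) μ s - segT A y μ D)
      = ∑ π : Equiv.Perm (Fin 3), ∑ m : Fin 3, rterm A π y o μ D s m := by
    rw [← hsum]; push_cast; linarith
  have hq := sq_sum_le_card_mul_sum_sq (s := (Finset.univ : Finset (Equiv.Perm (Fin 3))))
    (f := fun π => ∑ m : Fin 3, rterm A π y o μ D s m)
  have hb := Finset.sum_le_card_nsmul (Finset.univ : Finset (Equiv.Perm (Fin 3)))
    (fun π => (∑ m : Fin 3, rterm A π y o μ D s m) ^ 2) _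
    (fun π _ => rsum_bound A hA L R hL hR0 hR π y o μ D s S hD hDS hsS hSN ho ho')
  rw [hcard, nsmul_eq_mul] at hb
  rw [hcard, ← hX] at hq
  have hE := blkE_nonneg A R y
  have hE' := blkE_nonneg A R (y + shv N μ D)
  have hLr : (L : ℝ) = 2 * R + 1 := by exact_mod_cast hL
  have hpos : 0 ≤ (S : ℝ) * (blkE A R y + blkE A R (y + shv N μ D)) := by positivity
  rw [hLr]
  push_cast at *
  nlinarith

lemma obox_card (L : ℕ) (R : ℤ) (hL : (L : ℤ) = 2 * R + 1) : (obox R).card = L ^ 3 := by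
  have : (R + 1 + R).toNat = L := by omega
  simp [obox, Fintype.card_piFinset, this]

lemma obox_face_card (L : ℕ) (R : ℤ) (hR0 : 0 ≤ R) (hL : (L : ℤ) = 2 * R + 1) (μ : Fin 3) :
    ((obox R).filter fun o => o μ = R).card = L ^ 2 := by
  have h : ((obox R).filter fun o => o μ = R)
      = Fintype.piFinset fun i => if i = μ then {R} else Finset.Icc (-R) R := by
    ext o
    simp only [Finset.mem_filter, obox, Fintype.mem_piFinset]
    constructor
    · rintro ⟨h1, h2⟩ i
      by_cases hi : i = μ
      · subst hi; simpa using h2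
      · simpa [hi] using h1 i
    · intro h
      have hm : o μ = R := by simpa using h μ
      refine ⟨fun i => ?_, hm⟩
      by_cases hi : i = μ
      · subst hi; rw [hm, Finset.mem_Icc]; omega
      · simpa [hi] using h i
  have : (R + 1 + R).toNat = L := by omega
  rw [h, Fintype.card_piFinset, Fin.prod_univ_three]
  fin_cases μ <;> simp [this] <;> ring

lemma sum_blocks (L N : ℕ) [NeZero N] (R : ℤ) (hL : (L : ℤ) = 2 * R + 1) (hR0 : 0 ≤ R)
    (hdvd : L ∣ N) (Y : Finset (TPt N))
    (hY : ∀ y, y ∈ Y ↔ ∀ i, ∃ c : ZMod N, y i = (L : ZMod N) * c) (f : TPt N → ℝ) :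
    ∑ x : TPt N, f x = ∑ y ∈ Y, ∑ o ∈ obox R, f (y + cvec N o) := by
  rw [← Finset.sum_product']
  symm
  refine Finset.sum_nbij (fun p => p.1 + cvec N p.2) (fun _ _ => Finset.mem_univ _) ?_ ?_
    (fun _ _ => rfl)
  · rintro ⟨y, o⟩ h ⟨y', o'⟩ h' he
    rw [Finset.mem_coe, Finset.mem_product] at h h'
    have ho : o = o' := by
      funext i
      have e := congrFun he i
      simp only [Pi.add_apply, cvec] at e
      obtain ⟨c, hc⟩ := (hY y).1 h.1 i
      obtain ⟨c', hc'⟩ := (hY y').1 h'.1 i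
      rw [hc, hc'] at e
      have e2 := congrArg (ZMod.castHom hdvd (ZMod L)) e
      simp only [map_add, map_mul, map_natCast, map_intCast, ZMod.natCast_self, zero_mul,
        zero_add] at e2
      have e3 := (ZMod.intCast_eq_intCast_iff_dvd_sub _ _ _).1 e2
      have b := abs_le.1 (mem_box.1 h.2 i)
      have b' := abs_le.1 (mem_box.1 h'.2 i)
      obtain ⟨k, hk⟩ := e3
      simp only at b b'
      have hk0 : k = 0 := by
        have h1 : k < 1 := by by_contra hcon; nlinarith
        have h2 : -1 < k := by by_contra hcon; nlinarith
        omega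
      subst hk0; omega
    subst ho
    simp only [add_left_inj] at he
    rw [he]
  · intro x _
    have hLpos : (0 : ℤ) < L := by omega
    set o : Fin 3 → ℤ := fun i => (((x i).val : ℤ) + R) % L - R with ho
    refine ⟨(x - cvec N o, o), ?_, by simp⟩
    rw [Finset.mem_coe, Finset.mem_product]
    constructor
    · refine (hY _).2 fun i => ⟨(((((x i).val : ℤ) + R) / L : ℤ) : ZMod N), ?_⟩
      have e : ((x i).val : ℤ) - o i = L * ((((x i).val : ℤ) + R) / L) := by
        have := Int.emod_add_mul_ediv (((x i).val : ℤ) + R) L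
        simp only [ho]; linarith
      have e2 := congrArg (Int.cast : ℤ → ZMod N) e
      push_cast at e2
      simpa [cvec] using e2
    · rw [mem_box]
      intro i
      have h1 := Int.emod_nonneg (((x i).val : ℤ) + R) hLpos.ne'
      have h2 := Int.emod_lt_of_pos (((x i).val : ℤ) + R) hLpos
      simp only [ho]
      rw [abs_le]; omega

lemma coarse_shift (L N : ℕ) (y : TPt N) (μ : Fin 3)
    (h : ∀ i, ∃ c : ZMod N, y i = (L : ZMod N) * c) (e : ℤ) :
    ∀ i, ∃ c : ZMod N, (y + shv N μ (e * L)) i = (L : ZMod N) * c := by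
  intro i
  obtain ⟨c, hc⟩ := h i
  by_cases hi : i = μ
  · refine ⟨c + e, ?_⟩
    simp [shv, hi]; rw [← hi, hc]; ring
  · exact ⟨c, by simp [shv, hi, hc]⟩

lemma sum_shift (L N : ℕ) (Y : Finset (TPt N))
    (hY : ∀ y, y ∈ Y ↔ ∀ i, ∃ c : ZMod N, y i = (L : ZMod N) * c) (μ : Fin 3)
    (g : TPt N → ℝ) : ∑ y ∈ Y, g (y + shv N μ L) = ∑ y ∈ Y, g y := by
  refine Finset.sum_nbij' (fun y => y + shv N μ L) (fun y => y + shv N μ (-(L : ℤ))) ?_ ?_ ?_ ?_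
    (fun _ _ => rfl)
  · intro y hy
    have := coarse_shift L N y μ ((hY y).1 hy) 1
    rw [one_mul] at this
    exact (hY _).2 this
  · intro y hy
    have := coarse_shift L N y μ ((hY y).1 hy) (-1)
    rw [neg_one_mul] at this
    exact (hY _).2 this
  · intro y _; simp [shv_neg]
  · intro y _; simp [shv_neg]

lemma bond_bound {N : ℕ} [NeZero N] (A : TPt N → TPt N → ℝ) (hA : ∀ x x', A x x' = - A x' x)
    (L : ℕ) (R : ℤ) (hL : (L : ℤ) = 2 * R + 1) (hR0 : 0 ≤ R) (hRL : ((L : ℤ) - 1) / 2 = R)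
    (hLN : L ≤ N) (hR : 2 * R < N) (y : TPt N) (μ : Fin 3)
    (ht : ∀ x ∈ blockF N R y, tauBlk A y x = 0)
    (ht' : ∀ x ∈ blockF N R (y + shv N μ L), tauBlk A (y + shv N μ L) x = 0)
    (o : Fin 3 → ℤ) (ho : o ∈ obox R) :
    (A (y + cvec N o) (y + cvec N o + unitVec N μ)) ^ 2
      ≤ 4 * (L : ℝ) * blkE A R y + if o μ = R then
          12 * (L : ℝ) ^ 2 * (blkE A R y + blkE A R (y + shv N μ L))
            + 3 * (L : ℝ) ^ 2 * (Qc L A y μ) ^ 2 else 0 := by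
  have hE := blkE_nonneg A R y
  have hE' := blkE_nonneg A R (y + shv N μ L)
  have hL1 : 1 ≤ L := by omega
  have hLr : (0 : ℝ) < L := by exact_mod_cast hL1
  rw [mem_box] at ho
  have b := abs_le.1 (ho μ)
  rw [← seg_one A (y + cvec N o) μ]
  split_ifs with hm
  · set E2 := blkE A R y + blkE A R (y + shv N μ L) with hE2
    set W := segT A y μ L with hW
    have h1 := loop_bound A hA L R hL hR0 hR y o μ L 1 L (Or.inr rfl) le_rfl hL1 hLN ho
      (by rw [abs_le]; push_cast; omega) ht ht'
    have h2 : ∀ o ∈ obox R, (segT A (y + cvec N o) μ L - W) ^ 2 ≤ 2 * (L * L : ℝ) * E2 := by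
      intro o ho
      rw [mem_box] at ho
      exact loop_bound A hA L R hL hR0 hR y o μ L L L (Or.inr rfl) le_rfl le_rfl hLN ho
        (by simpa using ho μ) ht ht'
    have hq : (L : ℝ) ^ 3 * (L * Qc L A y μ - W) = ∑ o ∈ obox R, (segT A (y + cvec N o) μ L - W) := by
      rw [Finset.sum_sub_distrib, Finset.sum_const, obox_card L R hL, nsmul_eq_mul, Qc, hRL,
        block_eq N R hR, Finset.sum_image (block_inj N R hR y)]
      push_cast
      field_simp
    have h3 : (L * Qc L A y μ - W) ^ 2 ≤ 2 * (L * L : ℝ) * E2 := by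
      have c1 := sq_sum_le_card_mul_sum_sq (s := obox R)
        (f := fun o => segT A (y + cvec N o) μ L - W)
      have c2 := Finset.sum_le_card_nsmul (obox R) _ _ h2
      rw [obox_card L R hL, nsmul_eq_mul] at c2
      rw [← hq, obox_card L R hL] at c1
      push_cast at c1 c2
      have hp : (0 : ℝ) < (L : ℝ) ^ 3 := by positivity
      have c3 : ((L : ℝ) ^ 3 * ((L : ℝ) ^ 3)) * (L * Qc L A y μ - W) ^ 2
          ≤ ((L : ℝ) ^ 3 * (L : ℝ) ^ 3) * (2 * (L * L : ℝ) * E2) := by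
        have := mul_le_mul_of_nonneg_left c2 hp.le
        nlinarith
      exact le_of_mul_le_mul_left c3 (by positivity)
    push_cast at h1
    set a := segT A (y + cvec N o) μ 1
    set q := (L : ℝ) * Qc L A y μ with hqd
    have e : 3 * (L : ℝ) ^ 2 * (Qc L A y μ) ^ 2 = 3 * q ^ 2 := by rw [hqd]; ring
    rw [e]
    have h4 : 0 ≤ 4 * (L : ℝ) * blkE A R y := by positivity
    have h5 : a ^ 2 ≤ 3 * ((a - W) ^ 2 + (q - W) ^ 2 + q ^ 2) := by
      nlinarith [sq_nonneg ((a - W) + (q - W)), sq_nonneg ((a - W) - q), sq_nonneg ((q - W) + q)]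
    nlinarith
  · have hs0 : shv N μ ((0 : ℕ) : ℤ) = 0 := by simpa using shv_zero N μ
    have hy0 : y + shv N μ ((0 : ℕ) : ℤ) = y := by rw [hs0, add_zero]
    have h1 := loop_bound A hA L R hL hR0 hR y o μ 0 1 1 (Or.inl rfl) (by omega) le_rfl
      (by omega) ho (by rw [abs_le]; push_cast; omega) ht (by rw [hy0]; exact ht)
    rw [hy0] at h1
    have hz : segT A y μ ((0 : ℕ) : ℤ) = 0 := by simpa using seg_zero A y μ
    rw [hz] at h1
    push_cast at h1
    rw [sub_zero] at h1
    linarith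

lemma block_bound {N : ℕ} [NeZero N] (A : TPt N → TPt N → ℝ) (hA : ∀ x x', A x x' = - A x' x)
    (L : ℕ) (R : ℤ) (hL : (L : ℤ) = 2 * R + 1) (hR0 : 0 ≤ R) (hRL : ((L : ℤ) - 1) / 2 = R)
    (hLN : L ≤ N) (hR : 2 * R < N) (y : TPt N) (μ : Fin 3)
    (ht : ∀ x ∈ blockF N R y, tauBlk A y x = 0)
    (ht' : ∀ x ∈ blockF N R (y + shv N μ L), tauBlk A (y + shv N μ L) x = 0) :
    ∑ o ∈ obox R, (A (y + cvec N o) (y + cvec N o + unitVec N μ)) ^ 2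
      ≤ (L : ℝ) ^ 4 * (16 * blkE A R y + 12 * blkE A R (y + shv N μ L)
          + 3 * (Qc L A y μ) ^ 2) := by
  refine (Finset.sum_le_sum fun o ho =>
    bond_bound A hA L R hL hR0 hRL hLN hR y μ ht ht' o ho).trans ?_
  rw [Finset.sum_add_distrib, ← Finset.sum_filter, Finset.sum_const, Finset.sum_const,
    obox_card L R hL, obox_face_card L R hR0 hL, nsmul_eq_mul, nsmul_eq_mul]
  push_cast
  apply le_of_eq
  ring

lemma core_bound {N : ℕ} [NeZero N] (A : TPt N → TPt N → ℝ) (hA : ∀ x x', A x x' = - A x' x)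
    (L r : ℕ) (hr : L = 2 * r + 1) (hdvd : L ∣ N) (Y : Finset (TPt N))
    (hY : ∀ y, y ∈ Y ↔ ∀ i, ∃ c : ZMod N, y i = (L : ZMod N) * c)
    (htau : ∀ y : TPt N, isCoarse L N y →
      ∀ x ∈ blockF N (((L : ℤ) - 1) / 2) y, tauBlk A y x = 0) :
    (∑ z : TPt N, ∑ α : Fin 3, ∑ β : Fin 3,
        if α < β then (plaqT A z α β) ^ 2 else 0)
      + (∑ y ∈ Y, ∑ μ : Fin 3, (Qc L A y μ) ^ 2)
    ≥ (108 * (L : ℝ) ^ 4)⁻¹ *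
        ∑ x : TPt N, ∑ μ : Fin 3, (A x (x + unitVec N μ)) ^ 2 := by
  have hLN : L ≤ N := Nat.le_of_dvd (Nat.pos_of_ne_zero (NeZero.ne N)) hdvd
  have hL : (L : ℤ) = 2 * (r : ℤ) + 1 := by omega
  have hRL : ((L : ℤ) - 1) / 2 = (r : ℤ) := by omega
  have hR : 2 * (r : ℤ) < N := by omega
  rw [hRL] at htau
  have hE : (∑ z : TPt N, ∑ α : Fin 3, ∑ β : Fin 3,
        if α < β then (plaqT A z α β) ^ 2 else 0) = ∑ y ∈ Y, blkE A r y := by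
    change ∑ z : TPt N, eden A z = _
    rw [sum_blocks L N r hL (by omega) hdvd Y hY]
    refine Finset.sum_congr rfl fun y _ => ?_
    rw [blkE, block_eq N r hR, Finset.sum_image (block_inj N r hR y)]
  have hmain : ∑ x : TPt N, ∑ μ : Fin 3, (A x (x + unitVec N μ)) ^ 2
      ≤ (L : ℝ) ^ 4 * (84 * ∑ y ∈ Y, blkE A r y + 3 * ∑ y ∈ Y, ∑ μ : Fin 3, (Qc L A y μ) ^ 2) := by
    calc ∑ x : TPt N, ∑ μ : Fin 3, (A x (x + unitVec N μ)) ^ 2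
        = ∑ μ : Fin 3, ∑ y ∈ Y, ∑ o ∈ obox r,
            (A (y + cvec N o) (y + cvec N o + unitVec N μ)) ^ 2 := by
          rw [Finset.sum_comm]
          exact Finset.sum_congr rfl fun μ _ => sum_blocks L N r hL (by omega) hdvd Y hY _
      _ ≤ ∑ μ : Fin 3, ∑ y ∈ Y, (L : ℝ) ^ 4 * (16 * blkE A r y + 12 * blkE A r (y + shv N μ L)
          + 3 * (Qc L A y μ) ^ 2) := by
          refine Finset.sum_le_sum fun μ _ => Finset.sum_le_sum fun y hy => ?_
          have hy1 := (hY y).1 hy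
          have hy2 := coarse_shift L N y μ hy1 1
          rw [one_mul] at hy2
          exact block_bound A hA L r hL (by omega) hRL hLN hR y μ (htau y hy1) (htau _ hy2)
      _ = (L : ℝ) ^ 4 * (84 * ∑ y ∈ Y, blkE A r y
            + 3 * ∑ y ∈ Y, ∑ μ : Fin 3, (Qc L A y μ) ^ 2) := by
          rw [Finset.sum_comm (s := Y)]
          simp only [← Finset.mul_sum, Finset.sum_add_distrib, sum_shift L N Y hY,
            Finset.sum_const, Finset.card_univ, Fintype.card_fin, nsmul_eq_mul]
          push_cast
          ring
  have hLr : (0 : ℝ) < L := by exact_mod_cast (by omega : 0 < L)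
  have hE0 : 0 ≤ ∑ y ∈ Y, blkE A r y := Finset.sum_nonneg fun y _ => blkE_nonneg A r y
  have hQ0 : 0 ≤ ∑ y ∈ Y, ∑ μ : Fin 3, (Qc L A y μ) ^ 2 :=
    Finset.sum_nonneg fun y _ => Finset.sum_nonneg fun μ _ => sq_nonneg _
  rw [hE, ge_iff_le, inv_mul_le_iff₀ (by positivity)]
  refine hmain.trans ?_
  rw [mul_comm (108 : ℝ), mul_assoc]
  refine mul_le_mul_of_nonneg_left ?_ (by positivity)
  linarith

/-- (Lower bound on the gauge-fixed quadratic form.)  For a gauge field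
`A` on `T` with `(τA)(y,x) = 0` for every coarse site `y` and every `x ∈ B(y)`:
`Σ_p dA(p)² + Σ_{⟨y,y'⟩} ((QA)(y,y'))² ≥ (1/(108L⁴)) Σ_b A(b)²`, where the first sum runs
over all plaquettes of `T`, the second over all unordered coarse bonds and the third over
all unordered bonds of `T`. -/
theorem global_coercivity (L M : ℕ) (hL3 : 3 ≤ L) (hLodd : Odd L) (hM : 2 ≤ M)
    [NeZero (L ^ M)]
    (A : TPt (L ^ M) → TPt (L ^ M) → ℝ) (hA : ∀ x x', A x x' = - A x' x)
    (htau : ∀ y : TPt (L ^ M), isCoarse L (L ^ M) y →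
      ∀ x ∈ blockF (L ^ M) (((L : ℤ) - 1) / 2) y, tauBlk A y x = 0) :
    (∑ z : TPt (L ^ M), ∑ α : Fin 3, ∑ β : Fin 3,
        if α < β then (plaqT A z α β) ^ 2 else 0)
      + (∑ y ∈ Finset.univ.filter (fun y : TPt (L ^ M) =>
            ∀ i, ∃ c : ZMod (L ^ M), y i = (L : ZMod (L ^ M)) * c),
          ∑ μ : Fin 3, (Qc L A y μ) ^ 2)
    ≥ (108 * (L : ℝ) ^ 4)⁻¹ *
        ∑ x : TPt (L ^ M), ∑ μ : Fin 3, (A x (x + unitVec (L ^ M) μ)) ^ 2 := by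
  obtain ⟨r, hr⟩ := hLodd
  exact core_bound A hA L r hr (dvd_pow_self L (by omega)) _ (fun y => by simp) htau
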